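/- Let G and H be connected graphs, let M be a nonempty proper module of G, and let G' be the graph obtained from G by replacing G[M] with H. If the maximum induced matchings of G[M] and of H have the same number of edges, and the maximum independent triangle packings of G[M] and of H have the same number of triangles, then the maximum number of triangles in an independent triangle packing of G is at most the maximum number of triangles in an independent triangle packing of G'. -/

import Mathlib

open SimpleGraph Set

/-- `M` is a module of `G`: every vertex outside `M` is adjacent to all of `M`
or to none of `M`. -/
def SimpleGraph.IsModuleSet {V : Type*} (G : SimpleGraph V) (M : Set V) : Prop :=
  ∀ v ∉ M, (∀ m ∈ M, G.Adj v m) ∨ (∀ m ∈ M, ¬ G.Adj v m)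

/-- The graph obtained from `G` by replacing `G[M]` with `H`: its vertices are
`(V ∖ M) ⊕ V(H)`, with the edges of `G` outside `M`, the edges of `H`, and all
edges between `N_G(M) ∖ M` and `V(H)`. -/
def modularReplacement {V W : Type*} (G : SimpleGraph V) (M : Set V)
    (H : SimpleGraph W) : SimpleGraph ({v : V // v ∉ M} ⊕ W) :=
  SimpleGraph.fromRel (fun x y =>
    match x, y with
    | Sum.inl u, Sum.inl v => G.Adj u.1 v.1
    | Sum.inl u, Sum.inr _ => ∃ m ∈ M, G.Adj u.1 m
    | Sum.inr _, Sum.inl _ => False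
    | Sum.inr u, Sum.inr v => H.Adj u v)

section Invariants

variable {V : Type*} (G : SimpleGraph V)

/-- A dominating set. -/
def IsDomSet (D : Set V) : Prop := ∀ v ∉ D, ∃ u ∈ D, G.Adj v u

/-- A minimum dominating set. -/
def IsMinDomSet (D : Set V) : Prop :=
  IsDomSet G D ∧ ∀ D', IsDomSet G D' → D.ncard ≤ D'.ncard

/-- The domination number. -/
noncomputable def domNum : ℕ := sInf {n | ∃ D, IsDomSet G D ∧ D.ncard = n}

/-- A vertex cover. -/
def IsVCover (C : Set V) : Prop := ∀ ⦃u v⦄, G.Adj u v → u ∈ C ∨ v ∈ C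

/-- A minimum vertex cover. -/
def IsMinVCover (C : Set V) : Prop :=
  IsVCover G C ∧ ∀ C', IsVCover G C' → C.ncard ≤ C'.ncard

/-- The vertex cover number. -/
noncomputable def vcNum : ℕ := sInf {n | ∃ C, IsVCover G C ∧ C.ncard = n}

/-- A connected vertex cover. -/
def IsCVCover (C : Set V) : Prop := IsVCover G C ∧ (G.induce C).Connected

/-- A minimum connected vertex cover. -/
def IsMinCVCover (C : Set V) : Prop :=
  IsCVCover G C ∧ ∀ C', IsCVCover G C' → C.ncard ≤ C'.ncard

/-- The connected vertex cover number. -/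
noncomputable def cvcNum : ℕ := sInf {n | ∃ C, IsCVCover G C ∧ C.ncard = n}

/-- A feedback vertex set: its removal leaves an acyclic graph. -/
def IsFVS (S : Set V) : Prop := (G.induce Sᶜ).IsAcyclic

/-- A minimum feedback vertex set. -/
def IsMinFVS (S : Set V) : Prop :=
  IsFVS G S ∧ ∀ S', IsFVS G S' → S.ncard ≤ S'.ncard

/-- The feedback vertex set number. -/
noncomputable def fvsNum : ℕ := sInf {n | ∃ S, IsFVS G S ∧ S.ncard = n}

/-- An odd cycle transversal: its removal leaves a bipartite graph. -/
def IsOCT (S : Set V) : Prop := (G.induce Sᶜ).Colorable 2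

/-- A minimum odd cycle transversal. -/
def IsMinOCT (S : Set V) : Prop :=
  IsOCT G S ∧ ∀ S', IsOCT G S' → S.ncard ≤ S'.ncard

/-- The odd cycle transversal number. -/
noncomputable def octNum : ℕ := sInf {n | ∃ S, IsOCT G S ∧ S.ncard = n}

/-- An independent set: pairwise non-adjacent vertices. -/
def IsIndepSet' (I : Set V) : Prop := I.Pairwise (fun u v => ¬ G.Adj u v)

/-- A partition of `G` into `k` (vertex-disjoint) paths covering all vertices. -/
def IsPathPartition (k : ℕ) (P : Fin k → (u : V) × (v : V) × G.Walk u v) : Prop :=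
  (∀ i, (P i).2.2.IsPath) ∧
  (∀ i j, i ≠ j → ∀ x, x ∈ (P i).2.2.support → x ∉ (P j).2.2.support) ∧
  (∀ x : V, ∃ i, x ∈ (P i).2.2.support)

/-- The minimum number of paths in a partition of `G` into paths. -/
noncomputable def pathPartitionNum : ℕ :=
  sInf {k | ∃ P : Fin k → (u : V) × (v : V) × G.Walk u v, IsPathPartition G k P}

/-- `G` has a Hamiltonian cycle. -/
def HasHamCycle : Prop := ∃ (v : V) (p : G.Walk v v), p.IsCycle ∧ ∀ u : V, u ∈ p.support

/-- The number of vertices of a longest induced path of `G`. -/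
noncomputable def lipNum : ℕ :=
  sSup {n | ∃ S : Set V, Nonempty (G.induce S ≃g pathGraph n)}

/-- `X` is an induced matching with `k` edges: `X` has `2k` vertices and the
subgraph induced by `X` is `1`-regular. -/
def IsInducedMatching (X : Set V) (k : ℕ) : Prop :=
  X.ncard = 2 * k ∧ ∀ v ∈ X, ∃! u, u ∈ X ∧ G.Adj v u

/-- The maximum number of edges of an induced matching of `G`. -/
noncomputable def imNum : ℕ := sSup {k | ∃ X, IsInducedMatching G X k}

/-- An independent triangle packing with `k` triangles: pairwise disjoint
triangles with no edges of `G` between different triangles. -/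
def IsIndepTrianglePacking (k : ℕ) (f : Fin k → Set V) : Prop :=
  (∀ i, ∃ a b c : V, f i = {a, b, c} ∧ G.Adj a b ∧ G.Adj a c ∧ G.Adj b c) ∧
  (∀ i j, i ≠ j → ∀ u ∈ f i, ∀ v ∈ f j, u ≠ v ∧ ¬ G.Adj u v)

/-- The maximum number of triangles in an independent triangle packing of `G`. -/
noncomputable def itpNum : ℕ :=
  sSup {k | ∃ f : Fin k → Set V, IsIndepTrianglePacking G k f}

/-- `C` is the vertex set of an induced cycle of `G`. -/
def IsCycleSet (C : Set V) : Prop :=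
  3 ≤ C.ncard ∧ (G.induce C).Connected ∧ ∀ v ∈ C, {u | u ∈ C ∧ G.Adj v u}.ncard = 2

/-- An independent cycle packing with `k` cycles: pairwise disjoint induced
cycles with no edges of `G` between different cycles. -/
def IsIndepCyclePacking (k : ℕ) (f : Fin k → Set V) : Prop :=
  (∀ i, IsCycleSet G (f i)) ∧
  (∀ i j, i ≠ j → ∀ u ∈ f i, ∀ v ∈ f j, u ≠ v ∧ ¬ G.Adj u v)

/-- The maximum number of cycles in an independent cycle packing of `G`. -/
noncomputable def icpNum : ℕ :=
  sSup {k | ∃ f : Fin k → Set V, IsIndepCyclePacking G k f}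

end Invariants

section ModularReplacement

variable {V W : Type*} {G : SimpleGraph V} {M : Set V} {H : SimpleGraph W}

theorem modularReplacement_adj_inl_inl {u v : {v : V // v ∉ M}} :
    (modularReplacement G M H).Adj (Sum.inl u) (Sum.inl v) ↔ G.Adj u.1 v.1 := by
  simp only [modularReplacement, SimpleGraph.fromRel_adj]
  constructor
  · rintro ⟨-, h | h⟩
    exacts [h, h.symm]
  · intro h
    refine ⟨fun e => h.ne ?_, Or.inl h⟩
    rw [Sum.inl.inj e]

theorem modularReplacement_adj_inl_inr {u : {v : V // v ∉ M}} {w : W} :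
    (modularReplacement G M H).Adj (Sum.inl u) (Sum.inr w) ↔ ∃ m ∈ M, G.Adj u.1 m := by
  simp [modularReplacement]

theorem modularReplacement_adj_inr_inr {w w' : W} :
    (modularReplacement G M H).Adj (Sum.inr w) (Sum.inr w') ↔ H.Adj w w' := by
  simp only [modularReplacement, SimpleGraph.fromRel_adj]
  constructor
  · rintro ⟨-, h | h⟩
    exacts [h, h.symm]
  · intro h
    exact ⟨fun e => h.ne (Sum.inr.inj e), Or.inl h⟩

theorem SimpleGraph.IsModuleSet.adj_of_adj (hM : G.IsModuleSet M) {v m m' : V} (hv : v ∉ M)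
    (hm : m ∈ M) (hm' : m' ∈ M) (h : G.Adj v m) : G.Adj v m' :=
  (hM v hv).elim (fun H => H m' hm') fun H => absurd h (H m hm)

open Classical in
/-- The vertex of the modular replacement corresponding to `v`, where the vertices of `M` are
sent to `H` through `ψ`. -/
noncomputable def modularReplacementMap (M : Set V) (ψ : V → W) (v : V) :
    {v : V // v ∉ M} ⊕ W :=
  if h : v ∈ M then Sum.inr (ψ v) else Sum.inl ⟨v, h⟩

theorem modularReplacementMap_of_mem {ψ : V → W} {v : V} (h : v ∈ M) :
    modularReplacementMap M ψ v = Sum.inr (ψ v) := dif_pos h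

theorem modularReplacementMap_of_notMem {ψ : V → W} {v : V} (h : v ∉ M) :
    modularReplacementMap M ψ v = Sum.inl ⟨v, h⟩ := dif_neg h

theorem modularReplacementMap_adj {ψ : V → W} {u v : V} (huv : G.Adj u v)
    (hψ : u ∈ M → v ∈ M → H.Adj (ψ u) (ψ v)) :
    (modularReplacement G M H).Adj (modularReplacementMap M ψ u)
      (modularReplacementMap M ψ v) := by
  by_cases hu : u ∈ M <;> by_cases hv : v ∈ M
  · rw [modularReplacementMap_of_mem hu, modularReplacementMap_of_mem hv]
    exact modularReplacement_adj_inr_inr.2 (hψ hu hv)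
  · rw [modularReplacementMap_of_mem hu, modularReplacementMap_of_notMem hv]
    exact (modularReplacement_adj_inl_inr.2 ⟨u, hu, huv.symm⟩).symm
  · rw [modularReplacementMap_of_notMem hu, modularReplacementMap_of_mem hv]
    exact modularReplacement_adj_inl_inr.2 ⟨v, hv, huv⟩
  · rw [modularReplacementMap_of_notMem hu, modularReplacementMap_of_notMem hv]
    exact modularReplacement_adj_inl_inl.2 huv

theorem modularReplacementMap_ne_and_not_adj (hM : G.IsModuleSet M) {ψ ψ' : V → W} {u v : V}
    (huv : u ≠ v ∧ ¬ G.Adj u v)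
    (hψ : u ∈ M → v ∈ M → ψ u ≠ ψ' v ∧ ¬ H.Adj (ψ u) (ψ' v)) :
    modularReplacementMap M ψ u ≠ modularReplacementMap M ψ' v ∧
      ¬ (modularReplacement G M H).Adj (modularReplacementMap M ψ u)
        (modularReplacementMap M ψ' v) := by
  by_cases hu : u ∈ M <;> by_cases hv : v ∈ M
  · rw [modularReplacementMap_of_mem hu, modularReplacementMap_of_mem hv,
      modularReplacement_adj_inr_inr]
    exact ⟨fun e => (hψ hu hv).1 (Sum.inr.inj e), (hψ hu hv).2⟩
  · rw [modularReplacementMap_of_mem hu, modularReplacementMap_of_notMem hv,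
      SimpleGraph.adj_comm, modularReplacement_adj_inl_inr]
    refine ⟨Sum.inr_ne_inl, ?_⟩
    rintro ⟨m, hm, h⟩
    exact huv.2 (hM.adj_of_adj hv hm hu h).symm
  · rw [modularReplacementMap_of_notMem hu, modularReplacementMap_of_mem hv,
      modularReplacement_adj_inl_inr]
    refine ⟨Sum.inl_ne_inr, ?_⟩
    rintro ⟨m, hm, h⟩
    exact huv.2 (hM.adj_of_adj hu hm hv h)
  · rw [modularReplacementMap_of_notMem hu, modularReplacementMap_of_notMem hv,
      modularReplacement_adj_inl_inl]
    exact ⟨fun e => huv.1 (congrArg Subtype.val (Sum.inl.inj e)), huv.2⟩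

/-- An independent triangle packing of `G` transfers to the modular replacement as soon as the
parts of its triangles inside `M` can be mapped to pairwise separated parts of `H`. -/
theorem IsIndepTrianglePacking.image_modularReplacementMap (hM : G.IsModuleSet M) {k : ℕ}
    {f : Fin k → Set V} (hf : IsIndepTrianglePacking G k f) (ψ : Fin k → V → W)
    (hadj : ∀ i, ∀ u ∈ f i, ∀ v ∈ f i, u ∈ M → v ∈ M → G.Adj u v → H.Adj (ψ i u) (ψ i v))
    (hsep : ∀ i j, i ≠ j → ∀ u ∈ f i, ∀ v ∈ f j, u ∈ M → v ∈ M →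
      ψ i u ≠ ψ j v ∧ ¬ H.Adj (ψ i u) (ψ j v)) :
    IsIndepTrianglePacking (modularReplacement G M H) k
      (fun i => modularReplacementMap M (ψ i) '' f i) := by
  refine ⟨fun i => ?_, ?_⟩
  · obtain ⟨a, b, c, he, hab, hac, hbc⟩ := hf.1 i
    have ha : a ∈ f i := by simp [he]
    have hb : b ∈ f i := by simp [he]
    have hc : c ∈ f i := by simp [he]
    refine ⟨_, _, _, ?_,
      modularReplacementMap_adj hab fun h h' => hadj i a ha b hb h h' hab,
      modularReplacementMap_adj hac fun h h' => hadj i a ha c hc h h' hac,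
      modularReplacementMap_adj hbc fun h h' => hadj i b hb c hc h h' hbc⟩
    simp only [he, Set.image_insert_eq, Set.image_singleton]
  · rintro i j hij _ ⟨u, hu, rfl⟩ _ ⟨v, hv, rfl⟩
    exact modularReplacementMap_ne_and_not_adj hM (hf.2 i j hij u hu v hv)
      (hsep i j hij u hu v hv)

end ModularReplacement

section Packing

variable {V W : Type*} {G : SimpleGraph V} {H : SimpleGraph W}

theorem isIndepTrianglePacking_zero : IsIndepTrianglePacking G 0 Fin.elim0 :=
  ⟨fun i => i.elim0, fun i => i.elim0⟩

theorem bddAbove_isIndepTrianglePacking [Finite V] (G : SimpleGraph V) :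
    BddAbove {k | ∃ f : Fin k → Set V, IsIndepTrianglePacking G k f} := by
  refine ⟨Nat.card V, ?_⟩
  rintro k ⟨f, hf⟩
  have hne : ∀ i, ∃ a, a ∈ f i := fun i => by
    obtain ⟨a, b, c, he, -⟩ := hf.1 i
    exact ⟨a, by simp [he]⟩
  choose a ha using hne
  have hinj : Function.Injective a := fun i j hij => by
    by_contra h
    exact (hf.2 i j h _ (ha i) _ (ha j)).1 hij
  simpa using Nat.card_le_card_of_injective a hinj

theorem IsIndepTrianglePacking.le_itpNum [Finite V] {k : ℕ} {f : Fin k → Set V}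
    (hf : IsIndepTrianglePacking G k f) : k ≤ itpNum G :=
  le_csSup (bddAbove_isIndepTrianglePacking G) ⟨f, hf⟩

theorem exists_isIndepTrianglePacking_itpNum [Finite V] (G : SimpleGraph V) :
    ∃ f : Fin (itpNum G) → Set V, IsIndepTrianglePacking G (itpNum G) f :=
  Nat.sSup_mem (s := {k | ∃ f : Fin k → Set V, IsIndepTrianglePacking G k f})
    ⟨0, _, isIndepTrianglePacking_zero⟩ (bddAbove_isIndepTrianglePacking G)

theorem bddAbove_isInducedMatching [Finite V] (G : SimpleGraph V) :
    BddAbove {k | ∃ X, IsInducedMatching G X k} := by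
  refine ⟨Nat.card V, ?_⟩
  rintro k ⟨X, hX, -⟩
  have := Set.ncard_le_card X
  omega

theorem exists_isInducedMatching_imNum [Finite V] (G : SimpleGraph V) :
    ∃ X, IsInducedMatching G X (imNum G) :=
  Nat.sSup_mem (s := {k | ∃ X, IsInducedMatching G X k})
    ⟨0, ∅, by simp [IsInducedMatching]⟩ (bddAbove_isInducedMatching G)

theorem imNum_pos_iff [Finite V] : 0 < imNum G ↔ ∃ a b, G.Adj a b := by
  constructor
  · intro h
    obtain ⟨X, hX, hu⟩ := exists_isInducedMatching_imNum G
    obtain ⟨a, ha⟩ := Set.nonempty_of_ncard_ne_zero (s := X) (by omega)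
    obtain ⟨b, ⟨-, hb⟩, -⟩ := hu a ha
    exact ⟨a, b, hb⟩
  · rintro ⟨a, b, h⟩
    refine le_csSup (bddAbove_isInducedMatching G) ⟨{a, b}, ?_, ?_⟩
    · simpa using Set.ncard_pair h.ne
    · rintro v (rfl | rfl)
      · refine ⟨b, ⟨by simp, h⟩, ?_⟩
        rintro u ⟨rfl | rfl, hu⟩
        exacts [absurd hu G.irrefl, rfl]
      · refine ⟨a, ⟨by simp, h.symm⟩, ?_⟩
        rintro u ⟨rfl | rfl, hu⟩
        exacts [rfl, absurd hu G.irrefl]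

theorem card_le_itpNum_induce [Finite V] {M : Set V} {k : ℕ} {f : Fin k → Set V}
    (hf : IsIndepTrianglePacking G k f) (S : Finset (Fin k)) (hS : ∀ i ∈ S, f i ⊆ M) :
    S.card ≤ itpNum (G.induce M) := by
  let e := S.equivFin.symm
  refine IsIndepTrianglePacking.le_itpNum
    (f := fun j => (Subtype.val ⁻¹' f (e j) : Set M)) ⟨fun j => ?_, ?_⟩
  · obtain ⟨a, b, c, he, hab, hac, hbc⟩ := hf.1 (e j)
    have hsub := hS _ (e j).2
    refine ⟨⟨a, hsub (by simp [he])⟩, ⟨b, hsub (by simp [he])⟩, ⟨c, hsub (by simp [he])⟩,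
      ?_, hab, hac, hbc⟩
    ext x
    simp [he, Subtype.ext_iff]
  · intro i j hij u hu v hv
    obtain ⟨h1, h2⟩ := hf.2 (e i) (e j)
      (fun h => hij (e.injective (Subtype.ext h))) u hu v hv
    exact ⟨fun h => h1 (congrArg Subtype.val h), h2⟩

open Classical in
theorem exists_map_triangle {s : Set V} {t : Set W}
    (hs : ∃ a b c, s = {a, b, c} ∧ G.Adj a b ∧ G.Adj a c ∧ G.Adj b c)
    (ht : ∃ a b c, t = {a, b, c} ∧ H.Adj a b ∧ H.Adj a c ∧ H.Adj b c) :
    ∃ ψ : V → W, (∀ v, ψ v ∈ t) ∧ ∀ u ∈ s, ∀ v ∈ s, G.Adj u v → H.Adj (ψ u) (ψ v) := by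
  obtain ⟨a, b, c, rfl, hab, hac, hbc⟩ := hs
  obtain ⟨x, y, z, rfl, hxy, hxz, hyz⟩ := ht
  refine ⟨fun v => if v = a then x else if v = b then y else z, fun v => ?_, ?_⟩
  · dsimp only
    split_ifs <;> simp
  · have h1 := hab.ne'
    have h2 := hac.ne'
    have h3 := hbc.ne'
    rintro u (rfl | rfl | rfl) v (rfl | rfl | rfl) huv <;>
      simp_all [SimpleGraph.adj_comm]

end Packing

theorem stmt18 {V W : Type*} [Fintype V] [Fintype W]
    (G : SimpleGraph V) (H : SimpleGraph W) (M : Set V)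
    (hG : G.Connected) (hH : H.Connected)
    (hMod : G.IsModuleSet M) (hne : M.Nonempty) (hproper : M ≠ Set.univ)
    (him : imNum (G.induce M) = imNum H)
    (hitp : itpNum (G.induce M) = itpNum H) :
    itpNum G ≤ itpNum (modularReplacement G M H) := by
  classical
  refine csSup_le ⟨0, _, isIndepTrianglePacking_zero⟩ ?_
  rintro k ⟨f, hf⟩
  suffices h : ∃ ψ : Fin k → V → W,
      (∀ i, ∀ u ∈ f i, ∀ v ∈ f i, u ∈ M → v ∈ M → G.Adj u v → H.Adj (ψ i u) (ψ i v)) ∧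
      (∀ i j, i ≠ j → ∀ u ∈ f i, ∀ v ∈ f j, u ∈ M → v ∈ M →
        ψ i u ≠ ψ j v ∧ ¬ H.Adj (ψ i u) (ψ j v)) by
    obtain ⟨ψ, hadj, hsep⟩ := h
    exact (hf.image_modularReplacementMap hMod ψ hadj hsep).le_itpNum
  have : Nonempty W := hH.nonempty
  by_cases hcross : ∃ i, ∃ x ∈ f i, ∃ y ∈ f i, x ∉ M ∧ y ∈ M
  · obtain ⟨i, x, hx, y, hy, hxM, hyM⟩ := hcross
    have htri : ∀ u ∈ f i, ∀ v ∈ f i, u ≠ v → G.Adj u v := by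
      obtain ⟨a, b, c, he, hab, hac, hbc⟩ := hf.1 i
      rw [he]
      rintro u (rfl | rfl | rfl) v (rfl | rfl | rfl) huv <;>
        simp_all [SimpleGraph.adj_comm]
    have honly : ∀ j, ∀ u ∈ f j, u ∈ M → j = i := fun j u hu huM => by
      by_contra hji
      have hxy : G.Adj x y := htri x hx y hy fun h => hxM (h ▸ hyM)
      exact (hf.2 i j (Ne.symm hji) x hx u hu).2 (hMod.adj_of_adj hxM hyM huM hxy)
    have hsep : ∀ ψ : Fin k → V → W, ∀ j l, j ≠ l → ∀ u ∈ f j, ∀ v ∈ f l, u ∈ M → v ∈ M →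
        ψ j u ≠ ψ l v ∧ ¬ H.Adj (ψ j u) (ψ l v) := fun ψ j l hjl u hu v hv huM hvM =>
      absurd ((honly j u hu huM).trans (honly l v hv hvM).symm) hjl
    by_cases hedge : ∃ a ∈ f i, ∃ b ∈ f i, a ∈ M ∧ b ∈ M ∧ G.Adj a b
    · obtain ⟨a, ha, b, hb, haM, hbM, hab⟩ := hedge
      have hpos : 0 < imNum (G.induce M) := imNum_pos_iff.2 ⟨⟨a, haM⟩, ⟨b, hbM⟩, hab⟩
      obtain ⟨w, w', hw⟩ := imNum_pos_iff.1 (him ▸ hpos)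
      refine ⟨fun _ v => if v = a then w else w', fun j u hu v hv huM hvM huv => ?_, hsep _⟩
      obtain rfl := honly j u hu huM
      have hmem : ∀ z ∈ f j, z ∈ M → z = a ∨ z = b := by
        obtain ⟨p, q, r, he, hpq, hpr, hqr⟩ := hf.1 j
        simp only [he, Set.mem_insert_iff, Set.mem_singleton_iff] at hx ha hb ⊢
        have := hab.ne
        grind
      have hba := hab.ne'
      rcases hmem u hu huM with rfl | rfl <;> rcases hmem v hv hvM with rfl | rfl <;>
        simp_all [SimpleGraph.adj_comm]
    · obtain ⟨w⟩ := this
      refine ⟨fun _ _ => w, fun j u hu v hv huM hvM huv => ?_, hsep _⟩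
      obtain rfl := honly j u hu huM
      exact absurd ⟨u, hu, v, hv, huM, hvM, huv⟩ hedge
  · let S : Finset (Fin k) := Finset.univ.filter fun i => f i ⊆ M
    have hmemS : ∀ i, ∀ u ∈ f i, u ∈ M → i ∈ S := fun i u hu huM => by
      refine Finset.mem_filter.2 ⟨Finset.mem_univ _, fun v hv => ?_⟩
      by_contra hvM
      exact hcross ⟨i, v, hv, u, hu, hvM, huM⟩
    have hcard : S.card ≤ itpNum H :=
      hitp ▸ card_le_itpNum_induce hf S fun i hi => (Finset.mem_filter.1 hi).2
    obtain ⟨h, hh⟩ := exists_isIndepTrianglePacking_itpNum H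
    let e : S → Fin (itpNum H) := fun i => Fin.castLE hcard (S.equivFin i)
    have he : Function.Injective e :=
      (Fin.castLE_injective hcard).comp S.equivFin.injective
    choose φ hφt hφ using fun i : S => exists_map_triangle (hf.1 i) (hh.1 (e i))
    refine ⟨fun i => if hi : i ∈ S then φ ⟨i, hi⟩ else fun _ => Classical.arbitrary W,
      fun i u hu v hv huM _ huv => ?_, fun i j hij u hu v hv huM hvM => ?_⟩
    · simp only [dif_pos (hmemS i u hu huM)]
      exact hφ _ u hu v hv huv
    · simp only [dif_pos (hmemS i u hu huM), dif_pos (hmemS j v hv hvM)]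
      exact hh.2 _ _ (fun h => hij (congrArg Subtype.val (he h))) _ (hφt _ _) _ (hφt _ _)
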